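/- arXiv:2504.03039 — 2 statements merged into one kernel-verified Lean document; each statement's English description precedes it below -/
import Mathlib

section
/- Let a, b, c, l be positive integers with n = a+b+c and n/gcd(a,b,c) = 2^l. Then: (a) there is a sequence of exactly l pouring steps transforming the state (a,b,c) into a state with two entries equal to 0, and no sequence of fewer than l pouring steps leads to a state with two entries equal to 0; (b) the state (a,b,c) is ⌊log₂ n⌋-pourable. -/
/-- A single pouring step between two vessels of a state on `k` vessels:
choose `i ≠ j` with `A i ≤ A j`, replace `A i` by `2 * A i` and `A j` by
`A j - A i`. -/
def PourStep {k : ℕ} (A B : Fin k → ℕ) : Prop :=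
  ∃ i j : Fin k, i ≠ j ∧ A i ≤ A j ∧
    B = Function.update (Function.update A i (2 * A i)) j (A j - A i)

/-- `PourSteps m A B` : the state `B` is reachable from `A` in exactly `m`
pouring steps. -/
def PourSteps {k : ℕ} : ℕ → (Fin k → ℕ) → (Fin k → ℕ) → Prop
  | 0, A, B => B = A
  | m + 1, A, B => ∃ C, PourStep A C ∧ PourSteps m C B

/-- A state is `p`-pourable if at most `p` pouring steps lead to a state
with an empty vessel. -/
def Pourable {k : ℕ} (p : ℕ) (A : Fin k → ℕ) : Prop :=
  ∃ m ≤ p, ∃ B : Fin k → ℕ, PourSteps m A B ∧ ∃ i, B i = 0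

theorem PourStep.const_mul {k : ℕ} {A B : Fin k → ℕ} (d : ℕ) (h : PourStep A B) :
    PourStep (fun i => d * A i) (fun i => d * B i) := by
  obtain ⟨i, j, hij, hle, rfl⟩ := h
  refine ⟨i, j, hij, Nat.mul_le_mul_left d hle, funext fun x => ?_⟩
  by_cases hj : x = j
  · subst hj
    simp [Nat.mul_sub]
  · by_cases hi : x = i
    · subst hi
      simp [hj, Nat.mul_left_comm]
    · simp [hi, hj]

theorem PourSteps.const_mul {k m : ℕ} {A B : Fin k → ℕ} (d : ℕ) (h : PourSteps m A B) :
    PourSteps m (fun i => d * A i) (fun i => d * B i) := by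
  induction m generalizing A with
  | zero => exact congrArg (fun (C : Fin k → ℕ) i => d * C i) h
  | succ m ih =>
    obtain ⟨C, hAC, hCB⟩ := h
    exact ⟨_, hAC.const_mul d, ih hCB⟩

theorem PourStep.dvd_two_mul {k g : ℕ} {A B : Fin k → ℕ} (h : PourStep A B)
    (hg : ∀ x, g ∣ B x) (x : Fin k) : g ∣ 2 * A x := by
  obtain ⟨i, j, hij, hle, rfl⟩ := h
  have hi : g ∣ 2 * A i := by simpa [hij] using hg i
  by_cases hxj : x = j
  · subst hxj
    have hj : g ∣ A x - A i := by simpa using hg x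
    have hsum : 2 * A x = 2 * (A x - A i) + 2 * A i := by omega
    exact hsum ▸ dvd_add (hj.mul_left 2) hi
  · by_cases hxi : x = i
    · exact hxi ▸ hi
    · have hx : g ∣ A x := by simpa [hxi, hxj] using hg x
      exact hx.mul_left 2

theorem PourSteps.dvd_two_pow_mul {k m g : ℕ} {A B : Fin k → ℕ} (h : PourSteps m A B)
    (hg : ∀ x, g ∣ B x) (x : Fin k) : g ∣ 2 ^ m * A x := by
  induction m generalizing A x with
  | zero =>
    obtain rfl : B = A := h
    simpa using hg x
  | succ m ih =>
    obtain ⟨C, hAC, hCB⟩ := h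
    have hstep := hAC.const_mul (2 ^ m)
    have := hstep.dvd_two_mul (ih hCB) x
    rwa [← mul_assoc, ← pow_succ'] at this

theorem PourStep.sum_eq {k : ℕ} {A B : Fin k → ℕ} (h : PourStep A B) :
    ∑ x, B x = ∑ x, A x := by
  obtain ⟨i, j, hij, hle, rfl⟩ := h
  have hi : i ∈ Finset.univ \ {j} := by simp [hij]
  rw [Finset.sum_update_of_mem (Finset.mem_univ j), Finset.sum_update_of_mem hi,
    ← Finset.add_sum_erase _ A (Finset.mem_univ j), ← Finset.sdiff_singleton_eq_erase,
    ← Finset.add_sum_erase _ A hi, ← Finset.sdiff_singleton_eq_erase i]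
  omega

theorem PourSteps.sum_eq {k m : ℕ} {A B : Fin k → ℕ} (h : PourSteps m A B) :
    ∑ x, B x = ∑ x, A x := by
  induction m generalizing A with
  | zero => exact congrArg (fun C : Fin k → ℕ => ∑ x, C x) h
  | succ m ih =>
    obtain ⟨C, hAC, hCB⟩ := h
    exact (ih hCB).trans hAC.sum_eq

theorem sum_dvd_of_two_zeros {B : Fin 3 → ℕ} {i j : Fin 3} (hij : i ≠ j)
    (hi : B i = 0) (hj : B j = 0) (x : Fin 3) : ∑ y, B y ∣ B x := by
  rw [Fin.sum_univ_three]
  fin_cases i <;> fin_cases j <;> fin_cases x <;> simp_all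

/-- When the sum is even and some entry is odd, exactly two entries are odd; pouring between
these makes all entries even and leaves an odd entry after halving. -/
theorem exists_pourStep_two_mul {A : Fin 3 → ℕ} (hsum : Even (∑ x, A x))
    (hodd : ∃ i, Odd (A i)) :
    ∃ C : Fin 3 → ℕ, PourStep A (fun x => 2 * C x) ∧ ∃ i, Odd (C i) := by
  obtain ⟨i, j, hij, hle, hi, hj, hrest⟩ : ∃ i j, i ≠ j ∧ A i ≤ A j ∧ Odd (A i) ∧ Odd (A j) ∧
      ∀ x, x ≠ i → x ≠ j → Even (A x) := by
    obtain ⟨i, j, hij, hi, hj, hrest⟩ : ∃ i j, i ≠ j ∧ Odd (A i) ∧ Odd (A j) ∧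
        ∀ x, x ≠ i → x ≠ j → Even (A x) := by
      simp only [Fin.sum_univ_three, Fin.exists_fin_succ, Fin.forall_fin_succ] at *
      simp [Nat.even_iff, Nat.odd_iff] at *
      omega
    rcases le_total (A i) (A j) with hle | hle
    · exact ⟨i, j, hij, hle, hi, hj, hrest⟩
    · exact ⟨j, i, hij.symm, hle, hj, hi, fun x hxj hxi => hrest x hxi hxj⟩
  have heven : ∀ x, 2 ∣ Function.update (Function.update A i (2 * A i)) j (A j - A i) x := by
    intro x
    by_cases hxj : x = j
    · subst hxj
      simpa using (Nat.Odd.sub_odd hj hi).two_dvd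
    · by_cases hxi : x = i
      · subst hxi
        simp [hxj]
      · simpa [hxi, hxj] using (hrest x hxi hxj).two_dvd
  choose C hC using heven
  refine ⟨C, ⟨i, j, hij, hle, funext fun x => (hC x).symm⟩, i, ?_⟩
  have hCi : A i = C i := by simpa [hij] using hC i
  exact hCi ▸ hi

theorem exists_pourSteps_two_zeros {l : ℕ} {A : Fin 3 → ℕ} (hsum : ∑ x, A x = 2 ^ l)
    (hodd : ∃ i, Odd (A i)) :
    ∃ B : Fin 3 → ℕ, PourSteps l A B ∧ ∃ i j : Fin 3, i ≠ j ∧ B i = 0 ∧ B j = 0 := by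
  induction l generalizing A with
  | zero =>
    refine ⟨A, rfl, ?_⟩
    rw [Fin.sum_univ_three, pow_zero] at hsum
    have hcases : (A 0 = 0 ∧ A 1 = 0) ∨ (A 0 = 0 ∧ A 2 = 0) ∨ (A 1 = 0 ∧ A 2 = 0) := by omega
    rcases hcases with h | h | h
    · exact ⟨0, 1, by decide, h⟩
    · exact ⟨0, 2, by decide, h⟩
    · exact ⟨1, 2, by decide, h⟩
  | succ l ih =>
    obtain ⟨C, hAC, hC⟩ := exists_pourStep_two_mul (hsum ▸ by simp [pow_succ]) hodd
    have hCsum : ∑ x, C x = 2 ^ l := by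
      have := hAC.sum_eq
      rw [← Finset.mul_sum, hsum, pow_succ'] at this
      omega
    obtain ⟨B, hCB, i, j, hij, hi, hj⟩ := ih hCsum hC
    exact ⟨fun x => 2 * B x, ⟨_, hAC, hCB.const_mul 2⟩, i, j, hij, by simp [hi], by simp [hj]⟩

theorem stmt10 (a b c l : ℕ) (ha : 0 < a) (hb : 0 < b) (hc : 0 < c) (hl : 0 < l)
    (h : (a + b + c) / Nat.gcd a (Nat.gcd b c) = 2 ^ l) :
    ((∃ B : Fin 3 → ℕ, PourSteps l ![a, b, c] B ∧
        ∃ i j : Fin 3, i ≠ j ∧ B i = 0 ∧ B j = 0) ∧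
      (∀ m : ℕ, m < l → ∀ B : Fin 3 → ℕ, PourSteps m ![a, b, c] B →
        ¬ ∃ i j : Fin 3, i ≠ j ∧ B i = 0 ∧ B j = 0)) ∧
    Pourable (Nat.log 2 (a + b + c)) ![a, b, c] := by
  set d := Nat.gcd a (Nat.gcd b c) with hd
  have hdpos : 0 < d := Nat.gcd_pos_of_pos_left _ ha
  have hda : d ∣ a := Nat.gcd_dvd_left _ _
  have hdb : d ∣ b := (Nat.gcd_dvd_right _ _).trans (Nat.gcd_dvd_left _ _)
  have hdc : d ∣ c := (Nat.gcd_dvd_right _ _).trans (Nat.gcd_dvd_right _ _)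
  have hn : a + b + c = d * 2 ^ l := by
    rw [← h, Nat.mul_div_cancel' (dvd_add (dvd_add hda hdb) hdc)]
  have hreach : ∃ B : Fin 3 → ℕ, PourSteps l ![a, b, c] B ∧
      ∃ i j : Fin 3, i ≠ j ∧ B i = 0 ∧ B j = 0 := by
    obtain ⟨x, hx⟩ := hda
    obtain ⟨y, hy⟩ := hdb
    obtain ⟨z, hz⟩ := hdc
    have hsum : ∑ i, ![x, y, z] i = 2 ^ l := by
      apply Nat.eq_of_mul_eq_mul_left hdpos
      rw [← hn, hx, hy, hz]
      simp [Fin.sum_univ_three, mul_add]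
    have hodd : ∃ i, Odd (![x, y, z] i) := by
      by_contra! hev
      have hx2 : 2 ∣ x := by simpa using (Nat.not_odd_iff_even.mp (hev 0)).two_dvd
      have hy2 : 2 ∣ y := by simpa using (Nat.not_odd_iff_even.mp (hev 1)).two_dvd
      have hz2 : 2 ∣ z := by simpa using (Nat.not_odd_iff_even.mp (hev 2)).two_dvd
      have hdvd : d * 2 ∣ d := by
        conv_rhs => rw [hd]
        refine Nat.dvd_gcd ?_ (Nat.dvd_gcd ?_ ?_)
        · rw [hx]; exact mul_dvd_mul_left d hx2
        · rw [hy]; exact mul_dvd_mul_left d hy2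
        · rw [hz]; exact mul_dvd_mul_left d hz2
      have := Nat.le_of_dvd hdpos hdvd
      omega
    obtain ⟨B, hB, i, j, hij, hi, hj⟩ := exists_pourSteps_two_zeros hsum hodd
    have hscale : (fun i => d * ![x, y, z] i) = ![a, b, c] := by
      funext i
      fin_cases i <;> simp [← hx, ← hy, ← hz]
    exact ⟨_, hscale ▸ hB.const_mul d, i, j, hij, by simp [hi], by simp [hj]⟩
  refine ⟨⟨hreach, ?_⟩, ?_⟩
  · rintro m hm B hB ⟨i, j, hij, hi, hj⟩
    have hdvd := hB.dvd_two_pow_mul (sum_dvd_of_two_zeros hij hi hj)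
    have hBsum : ∑ x, B x = d * 2 ^ l := by
      rw [hB.sum_eq, ← hn]
      simp [Fin.sum_univ_three]
    rw [hBsum] at hdvd
    have hgcd : d * 2 ^ l ∣ d * 2 ^ m := by
      rw [mul_comm d (2 ^ m), hd, ← Nat.gcd_mul_left, ← Nat.gcd_mul_left, ← hd]
      exact Nat.dvd_gcd (hdvd 0) (Nat.dvd_gcd (hdvd 1) (hdvd 2))
    have hpow : 2 ^ l ∣ 2 ^ m := Nat.dvd_of_mul_dvd_mul_left hdpos hgcd
    exact absurd ((Nat.pow_dvd_pow_iff_le_right (by norm_num)).mp hpow) (by omega)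
  · obtain ⟨B, hB, i, -, -, hi, -⟩ := hreach
    refine ⟨l, Nat.le_log_of_pow_le (by norm_num) ?_, B, hB, i, hi⟩
    rw [hn]
    exact Nat.le_mul_of_pos_left _ hdpos
end

section
/- For every integer k ≥ 3, g(4,k) ≥ ⌊(2k³ + 3k² + 22k)/24⌋; that is, every state on k vessels whose sum is less than ⌊(2k³ + 3k² + 22k)/24⌋ is 3-pourable. -/
/-- `g N k` : the smallest positive integer `n` such that some state on `k`
vessels with sum `n` is not `(N-1)`-pourable. -/
noncomputable def g (N k : ℕ) : ℕ :=
  sInf {n : ℕ | 0 < n ∧ ∃ A : Fin k → ℕ, (∑ i, A i) = n ∧ ¬ Pourable (N - 1) A}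

theorem Pourable.mono {k p q : ℕ} {A : Fin k → ℕ} (h : Pourable p A) (hpq : p ≤ q) :
    Pourable q A := by
  obtain ⟨m, hm, B, hB⟩ := h
  exact ⟨m, hm.trans hpq, B, hB⟩

theorem pourable_zero {k : ℕ} {A : Fin k → ℕ} {i : Fin k} (h : A i = 0) : Pourable 0 A :=
  ⟨0, le_rfl, A, rfl, i, h⟩

theorem PourStep.pourable_succ {k p : ℕ} {A B : Fin k → ℕ} (h : PourStep A B)
    (hB : Pourable p B) : Pourable (p + 1) A := by
  obtain ⟨m, hm, C, hC, h0⟩ := hB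
  exact ⟨m + 1, by omega, C, ⟨B, h, hC⟩, h0⟩

theorem pourable_one_of_eq {k : ℕ} {A : Fin k → ℕ} {i j : Fin k} (hij : i ≠ j)
    (h : A i = A j) : Pourable 1 A :=
  PourStep.pourable_succ ⟨i, j, hij, h.le, rfl⟩ (pourable_zero (i := j) (by simp [h]))

theorem pourable_two_of_add {k : ℕ} {A : Fin k → ℕ} {i j l : Fin k} (hij : i ≠ j)
    (hil : i ≠ l) (hjl : j ≠ l) (h : A i + A l = A j) : Pourable 2 A := by
  refine PourStep.pourable_succ ⟨i, j, hij, by omega, rfl⟩ (pourable_one_of_eq hjl ?_)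
  simp [Function.update_of_ne hjl.symm, Function.update_of_ne hil.symm]
  omega

theorem pourable_two_of_double {k : ℕ} {A : Fin k → ℕ} {i j m : Fin k} (hij : i ≠ j)
    (him : i ≠ m) (hjm : j ≠ m) (h : A j = 2 * A i) (hle : A i ≤ A m) : Pourable 2 A := by
  refine PourStep.pourable_succ ⟨i, m, him, hle, rfl⟩ (pourable_one_of_eq hij ?_)
  simp [Function.update_of_ne him, Function.update_of_ne hjm, Function.update_of_ne hij.symm, h]

theorem pourable_three_of_sub_eq {k : ℕ} {A : Fin k → ℕ} {i j l m : Fin k} (hij : i ≠ j)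
    (hil : i ≠ l) (him : i ≠ m) (hjl : j ≠ l) (hjm : j ≠ m) (hlm : l ≠ m)
    (hi : A i ≤ A j) (hl : A l ≤ A m) (h : A j - A i = A m - A l) : Pourable 3 A := by
  refine PourStep.pourable_succ ⟨i, j, hij, hi, rfl⟩ ?_
  refine PourStep.pourable_succ ⟨l, m, hlm, ?_, rfl⟩ (pourable_one_of_eq hjm ?_)
  · simpa [Function.update_of_ne hil.symm, Function.update_of_ne hjl.symm,
      Function.update_of_ne him.symm, Function.update_of_ne hjm.symm] using hl
  · simp [Function.update_of_ne hil.symm, Function.update_of_ne hjl.symm,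
      Function.update_of_ne him.symm, Function.update_of_ne hjm.symm,
      Function.update_of_ne hjl, Function.update_of_ne hjm, h]

/-- The arithmetic conditions that the contents of a state which is not 3-pourable satisfy. -/
structure PourFree (S : Finset ℕ) : Prop where
  pos : ∀ x ∈ S, 0 < x
  add : ∀ x ∈ S, ∀ y ∈ S, x ≠ y → x + y ∉ S
  double : ∀ x ∈ S, 2 * x ∈ S → ∀ y ∈ S, y ≠ 2 * x → y ≤ x
  sub : ∀ x ∈ S, ∀ y ∈ S, ∀ d, 0 < d → x + d ∈ S → y + d ∈ S → x ≠ y → x = y + d ∨ y = x + d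

theorem PourFree.subset {S T : Finset ℕ} (hS : PourFree S) (h : T ⊆ S) : PourFree T where
  pos x hx := hS.pos x (h hx)
  add x hx y hy hxy hT := hS.add x (h hx) y (h hy) hxy (h hT)
  double x hx h2 y hy := hS.double x (h hx) (h h2) y (h hy)
  sub x hx y hy d hd h1 h2 := hS.sub x (h hx) y (h hy) d hd (h h1) (h h2)

theorem pourFree_image {k : ℕ} {A : Fin k → ℕ} (h : ¬ Pourable 3 A) :
    PourFree (Finset.univ.image A) where
  pos x hx := by
    obtain ⟨i, -, rfl⟩ := Finset.mem_image.1 hx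
    exact Nat.pos_of_ne_zero fun h0 => h ((pourable_zero h0).mono (by norm_num))
  add x hx y hy hxy hz := by
    obtain ⟨i, -, rfl⟩ := Finset.mem_image.1 hx
    obtain ⟨l, -, rfl⟩ := Finset.mem_image.1 hy
    obtain ⟨j, -, hj⟩ := Finset.mem_image.1 hz
    have hi0 : A i ≠ 0 := fun h0 => h ((pourable_zero h0).mono (by norm_num))
    have hl0 : A l ≠ 0 := fun h0 => h ((pourable_zero h0).mono (by norm_num))
    refine h ((pourable_two_of_add (i := i) (j := j) (l := l) ?_ ?_ ?_ hj.symm).mono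
      (by norm_num)) <;> rintro rfl <;> omega
  double x hx h2 y hy hne := by
    obtain ⟨i, -, rfl⟩ := Finset.mem_image.1 hx
    obtain ⟨j, -, hj⟩ := Finset.mem_image.1 h2
    obtain ⟨m, -, rfl⟩ := Finset.mem_image.1 hy
    have hi0 : A i ≠ 0 := fun h0 => h ((pourable_zero h0).mono (by norm_num))
    by_contra! hlt
    refine h ((pourable_two_of_double (i := i) (j := j) (m := m) ?_ ?_ ?_ hj hlt.le).mono
      (by norm_num)) <;> rintro rfl <;> omega
  sub x hx y hy d hd h1 h2 hne := by
    obtain ⟨i, -, rfl⟩ := Finset.mem_image.1 hx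
    obtain ⟨l, -, rfl⟩ := Finset.mem_image.1 hy
    obtain ⟨j, -, hj⟩ := Finset.mem_image.1 h1
    obtain ⟨m, -, hm⟩ := Finset.mem_image.1 h2
    by_contra! hcon
    refine h (pourable_three_of_sub_eq (i := i) (j := j) (l := l) (m := m)
      ?_ ?_ ?_ ?_ ?_ ?_ (by omega) (by omega) (by omega)) <;> rintro rfl <;> omega

theorem injective_of_not_pourable {k : ℕ} {A : Fin k → ℕ} (h : ¬ Pourable 3 A) :
    Function.Injective A := fun i j hij => by
  by_contra hne
  exact h ((pourable_one_of_eq hne hij).mono (by norm_num))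

theorem two_mul_card_filter_lt_offDiag (S : Finset ℕ) :
    2 * (S.offDiag.filter fun p => p.1 < p.2).card = S.card * S.card - S.card := by
  have hsymm : (S.offDiag.filter fun p => ¬ p.1 < p.2).card
      = (S.offDiag.filter fun p => p.1 < p.2).card := by
    refine Finset.card_nbij' Prod.swap Prod.swap ?_ ?_ (fun _ _ => Prod.swap_swap _)
      (fun _ _ => Prod.swap_swap _) <;>
    · rintro ⟨a, b⟩ h
      simp only [SetLike.mem_coe, Finset.mem_filter, Finset.mem_offDiag, Prod.swap] at h ⊢
      obtain ⟨⟨h1, h2, h3⟩, h4⟩ := h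
      exact ⟨⟨h2, h1, h3.symm⟩, by omega⟩
  rw [← Finset.offDiag_card, ← Finset.card_filter_add_card_filter_not (s := S.offDiag)
    (fun p => p.1 < p.2), hsymm]
  ring

theorem PourFree.card_sq_le {S : Finset ℕ} (hS : PourFree S) {M : ℕ}
    (hM : ∀ x ∈ S, x ≤ M) : S.card * S.card + 3 * S.card ≤ 4 * M + 2 := by
  set P := S.offDiag.filter fun p => p.1 < p.2 with hP
  have hmem : ∀ p, p ∈ P ↔ p.1 ∈ S ∧ p.2 ∈ S ∧ p.1 < p.2 := by
    intro p
    simp only [hP, Finset.mem_filter, Finset.mem_offDiag]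
    constructor
    · rintro ⟨⟨h1, h2, -⟩, h⟩
      exact ⟨h1, h2, h⟩
    · rintro ⟨h1, h2, h⟩
      exact ⟨⟨h1, h2, h.ne⟩, h⟩
  have hdouble : (P.filter fun p => p.2 = 2 * p.1).card ≤ 1 := by
    rw [Finset.card_le_one]
    rintro ⟨a, b⟩ hab ⟨c, d⟩ hcd
    simp only [Finset.mem_filter, hmem] at hab hcd
    obtain ⟨⟨ha, hb, hlt⟩, rfl⟩ := hab
    obtain ⟨⟨hc, hd, hlt'⟩, rfl⟩ := hcd
    have h1 := hS.double a ha hb (2 * c) hd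
    have h2 := hS.double c hc hd (2 * a) hb
    have : a = c := by omega
    rw [this]
  have hSM : S ⊆ Finset.Icc 1 M := fun x hx => Finset.mem_Icc.2 ⟨hS.pos x hx, hM x hx⟩
  have hrest : (P.filter fun p => ¬ p.2 = 2 * p.1).card ≤ 2 * (Finset.Icc 1 M \ S).card := by
    refine Finset.card_le_mul_card_image_of_maps_to (f := fun p => p.2 - p.1) ?_ 2 ?_
    · rintro ⟨a, b⟩ hab
      simp only [Finset.mem_filter, hmem] at hab
      obtain ⟨⟨ha, hb, hlt⟩, hne⟩ := hab
      have hbM := hM b hb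
      simp only [Finset.mem_sdiff, Finset.mem_Icc]
      refine ⟨by omega, fun hd => hS.add a ha (b - a) hd (by omega) ?_⟩
      rwa [Nat.add_sub_cancel' hlt.le]
    · intro d hd
      have hd0 : 0 < d := by
        simp only [Finset.mem_sdiff, Finset.mem_Icc] at hd
        omega
      by_contra! hcard
      obtain ⟨⟨a, a'⟩, ⟨b, b'⟩, ⟨c, c'⟩, ha, hb, hc, hab, hac, hbc⟩ :=
        Finset.two_lt_card_iff.1 hcard
      simp only [Finset.mem_filter, hmem, Prod.mk.injEq, ne_eq] at ha hb hc hab hac hbc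
      obtain ⟨⟨⟨ha, ha', hlta⟩, -⟩, hda⟩ := ha
      obtain ⟨⟨⟨hb, hb', hltb⟩, -⟩, hdb⟩ := hb
      obtain ⟨⟨⟨hc, hc', hltc⟩, -⟩, hdc⟩ := hc
      obtain rfl : a' = a + d := by omega
      obtain rfl : b' = b + d := by omega
      obtain rfl : c' = c + d := by omega
      have h1 := hS.sub a ha b hb d hd0 ha' hb' (by omega)
      have h2 := hS.sub a ha c hc d hd0 ha' hc' (by omega)
      have h3 := hS.sub b hb c hc d hd0 hb' hc' (by omega)
      omega
  have hcardP := two_mul_card_filter_lt_offDiag S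
  have hsplit := Finset.card_filter_add_card_filter_not (s := P) (fun p => p.2 = 2 * p.1)
  have hdiff := Finset.card_sdiff_add_card_eq_card hSM
  rw [Nat.card_Icc] at hdiff
  rw [← hP] at hcardP
  have hle : S.card ≤ S.card * S.card := Nat.le_mul_self _
  omega

theorem PourFree.le_sum {S : Finset ℕ} (hS : PourFree S) :
    2 * S.card ^ 3 + 12 * S.card ^ 2 ≤ 24 * ∑ x ∈ S, x + 2 * S.card := by
  induction S using Finset.induction_on_max with
  | empty => simp
  | insert a s hlt ih =>
    have ha : a ∉ s := fun h => (hlt a h).false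
    have h1 := ih (hS.subset (Finset.subset_insert a s))
    have h2 := hS.card_sq_le (M := a) fun x hx => by
      rcases Finset.mem_insert.1 hx with rfl | hx
      · exact le_rfl
      · exact (hlt x hx).le
    rw [Finset.card_insert_of_notMem ha] at h2 ⊢
    rw [Finset.sum_insert ha]
    nlinarith

theorem le_sum_of_not_pourable {k : ℕ} (hk : 3 ≤ k) {A : Fin k → ℕ} (h : ¬ Pourable 3 A) :
    (2 * k ^ 3 + 3 * k ^ 2 + 22 * k) / 24 ≤ ∑ i, A i := by
  have hinj := injective_of_not_pourable h
  have hle := (pourFree_image h).le_sum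
  rw [Finset.card_image_of_injective _ hinj, Finset.card_univ, Fintype.card_fin,
    Finset.sum_image hinj.injOn] at hle
  refine Nat.div_le_of_le_mul ?_
  nlinarith

/-- The `i`-th vessel contains `64 ^ i` up to a factor `2 ^ p`. -/
def NearGeometric {k : ℕ} (p : ℕ) (A : Fin k → ℕ) : Prop :=
  ∀ i : Fin k, 64 ^ (i : ℕ) ≤ 2 ^ p * A i ∧ A i ≤ 2 ^ p * 64 ^ (i : ℕ)

theorem NearGeometric.mono {k p q : ℕ} {A : Fin k → ℕ} (hA : NearGeometric p A) (hpq : p ≤ q) :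
    NearGeometric q A := fun i =>
  ⟨(hA i).1.trans (by gcongr; norm_num), (hA i).2.trans (by gcongr; norm_num)⟩

theorem PourStep.nearGeometric {k p : ℕ} {A B : Fin k → ℕ} (h : PourStep A B)
    (hA : NearGeometric p A) (hp : p ≤ 2) : NearGeometric (p + 1) B := by
  obtain ⟨i, j, hij, hle, rfl⟩ := h
  have hgap : ∀ a b : Fin k, a < b → 64 * 64 ^ (a : ℕ) ≤ 64 ^ (b : ℕ) := fun a b hab => by
    rw [← pow_succ']
    exact Nat.pow_le_pow_right (by norm_num) hab
  have hpos : ∀ a : Fin k, 0 < 64 ^ (a : ℕ) := fun a => by positivity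
  have hAi := hA i
  have hAj := hA j
  have hlt : i < j := by
    by_contra hcon
    have := hgap j i (lt_of_le_of_ne (not_lt.1 hcon) hij.symm)
    have := hpos j
    interval_cases p <;> omega
  have hg := hgap i j hlt
  intro l
  rcases eq_or_ne l j with rfl | hlj
  · rw [Function.update_self]
    interval_cases p <;> omega
  rw [Function.update_of_ne hlj]
  rcases eq_or_ne l i with rfl | hli
  · rw [Function.update_self]
    interval_cases p <;> omega
  · rw [Function.update_of_ne hli]
    exact hA.mono (Nat.le_succ p) l

theorem PourSteps.nearGeometric {k m p : ℕ} {A B : Fin k → ℕ} (h : PourSteps m A B)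
    (hA : NearGeometric p A) (hp : p + m ≤ 3) : NearGeometric (p + m) B := by
  induction m generalizing p A with
  | zero =>
    obtain rfl : B = A := h
    exact hA
  | succ m ih =>
    obtain ⟨C, hC, hB⟩ := h
    have := ih hB (hC.nearGeometric hA (by omega)) (by omega)
    rwa [add_right_comm] at this

theorem not_pourable_geometric (k : ℕ) : ¬ Pourable 3 fun i : Fin k => 64 ^ (i : ℕ) := by
  rintro ⟨m, hm, B, hB, i, hi⟩
  have h := (hB.nearGeometric (p := 0) (fun i => by simp) (by omega) i).1
  rw [hi, mul_zero] at h
  exact absurd h (by simp)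

theorem stmt17 (k : ℕ) (hk : 3 ≤ k) :
    (2 * k ^ 3 + 3 * k ^ 2 + 22 * k) / 24 ≤ g 4 k ∧
      ∀ A : Fin k → ℕ, (∑ i, A i) < (2 * k ^ 3 + 3 * k ^ 2 + 22 * k) / 24 →
        Pourable 3 A := by
  refine ⟨?_, fun A hA => ?_⟩
  · have hne : {n : ℕ | 0 < n ∧ ∃ A : Fin k → ℕ, (∑ i, A i) = n ∧
        ¬ Pourable (4 - 1) A}.Nonempty := by
      refine ⟨_, ?_, _, rfl, not_pourable_geometric k⟩
      exact Finset.sum_pos (fun i _ => by positivity) ⟨⟨0, by omega⟩, Finset.mem_univ _⟩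
    obtain ⟨-, A, hA, hnot⟩ := Nat.sInf_mem hne
    exact (le_sum_of_not_pourable hk hnot).trans_eq hA
  · by_contra hnot
    exact (le_sum_of_not_pourable hk hnot).not_gt hA
end
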